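/- For every n ≥ 3, under the canonical unitary Θ: ((ℂ^2)^{⊗4})^{⊗n} → ((ℂ^2)^{⊗n})^{⊗4} permuting tensor factors (sending the four copies of qubit i to position i of each of the four global copies), the kernels satisfy: ker H_n = ker H^L_n = Θ(span{ψ_0^{⊗n}, ψ_1^{⊗n}}) and ker H^B_n = Θ(span{ψ_0^{⊗n}, ψ_1^{⊗n}, ψ_φ^{⊗n}}). In particular the ground spaces of H_n and H^L_n are 2-dimensional and that of H^B_n is 3-dimensional. -/

import Mathlib

open MeasureTheory Matrix Finset
open scoped Real ComplexConjugate ComplexOrder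

noncomputable section

instance {m n α : Type*} [MeasurableSpace α] : MeasurableSpace (Matrix m n α) :=
  inferInstanceAs (MeasurableSpace (m → n → α))

/-- The matrix exponential, defined by its power series. -/
def mexp {d : Type*} [Fintype d] [DecidableEq d] (A : Matrix d d ℂ) : Matrix d d ℂ :=
  ∑' k : ℕ, ((k.factorial : ℂ))⁻¹ • A ^ k

/-- `U^{⊗t}` as a matrix, entrywise. -/
def tpow {d : Type*} [Fintype d] (t : ℕ) (U : Matrix d d ℂ) :
    Matrix (Fin t → d) (Fin t → d) ℂ :=
  Matrix.of fun x y => ∏ i, U (x i) (y i)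

/-- `U^{⊗t,t} = U^{⊗t} ⊗ (conj U)^{⊗t}` as a matrix, entrywise. -/
def tpow2 {d : Type*} [Fintype d] (t : ℕ) (U : Matrix d d ℂ) :
    Matrix ((Fin t → d) × (Fin t → d)) ((Fin t → d) × (Fin t → d)) ℂ :=
  Matrix.of fun x y => (∏ i, U (x.1 i) (y.1 i)) * ∏ i, conj (U (x.2 i) (y.2 i))

/-- The Hilbert space of `n` qubits is indexed by bit strings `Fin n → Fin 2`. -/
abbrev QMat (n : ℕ) := Matrix (Fin n → Fin 2) (Fin n → Fin 2) ℂ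

def pauliX : Matrix (Fin 2) (Fin 2) ℂ := !![0, 1; 1, 0]
def pauliZ : Matrix (Fin 2) (Fin 2) ℂ := !![1, 0; 0, -1]
def hadamardMat : Matrix (Fin 2) (Fin 2) ℂ :=
  (((Real.sqrt 2 : ℝ) : ℂ))⁻¹ • !![1, 1; 1, -1]

/-- A single-qubit operator `A` acting on qubit `i` of `n` qubits. -/
def op1 {n : ℕ} (i : Fin n) (A : Matrix (Fin 2) (Fin 2) ℂ) : QMat n :=
  Matrix.of fun x y =>
    A (x i) (y i) * ∏ j ∈ Finset.univ.erase i, (if x j = y j then (1 : ℂ) else 0)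

/-- Pauli `X` on qubit `i`. -/
def Xop {n : ℕ} (i : Fin n) : QMat n := op1 i pauliX
/-- Pauli `Z` on qubit `i`. -/
def Zop {n : ℕ} (i : Fin n) : QMat n := op1 i pauliZ

/-- `ZXZ_i = Z_{i-1} X_i Z_{i+1}`, with the `Z` factors dropped at the boundary
(so `ZXZ_1 = X_1 Z_2` and `ZXZ_n = Z_{n-1} X_n`). -/
def ZXZop {n : ℕ} (i : Fin n) : QMat n :=
  (if h : 0 < (i : ℕ) then Zop ⟨(i : ℕ) - 1, by have := i.isLt; omega⟩ else 1) *
    Xop i *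
    (if h : (i : ℕ) + 1 < n then Zop ⟨(i : ℕ) + 1, h⟩ else 1)

/-- The gate `e^{iφ A}`. -/
def rotGate {n : ℕ} (φ : ℝ) (A : QMat n) : QMat n :=
  mexp ((Complex.I * (φ : ℂ)) • A)

/-- `P_A := (1/2π)∫₀^{2π} (e^{iφA})^{⊗2,2} dφ`, defined entrywise. -/
def Pproj {n : ℕ} (A : QMat n) :
    Matrix ((Fin 2 → (Fin n → Fin 2)) × (Fin 2 → (Fin n → Fin 2)))
           ((Fin 2 → (Fin n → Fin 2)) × (Fin 2 → (Fin n → Fin 2))) ℂ :=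
  Matrix.of fun x y =>
    ((2 * Real.pi : ℝ) : ℂ)⁻¹ * ∫ φ in (0 : ℝ)..(2 * Real.pi), tpow2 2 (rotGate φ A) x y

/-- `H_n = ∑ᵢ (1 - P^X_i) + ∑ᵢ (1 - P^Z_i) + ∑ᵢ (1 - P^{ZXZ}_i)`. -/
def Hham (n : ℕ) :
    Matrix ((Fin 2 → (Fin n → Fin 2)) × (Fin 2 → (Fin n → Fin 2)))
           ((Fin 2 → (Fin n → Fin 2)) × (Fin 2 → (Fin n → Fin 2))) ℂ :=
  (∑ i : Fin n, (1 - Pproj (Xop i))) + (∑ i : Fin n, (1 - Pproj (Zop i))) +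
    (∑ i : Fin n, (1 - Pproj (ZXZop i)))

/-- `H^L_n = H_n - (1 - P^{ZXZ}_n)` (boundary term at the right edge removed). -/
def HhamL (n : ℕ) (hn : 0 < n) :
    Matrix ((Fin 2 → (Fin n → Fin 2)) × (Fin 2 → (Fin n → Fin 2)))
           ((Fin 2 → (Fin n → Fin 2)) × (Fin 2 → (Fin n → Fin 2))) ℂ :=
  Hham n - (1 - Pproj (ZXZop (⟨n - 1, by omega⟩ : Fin n)))

/-- `H^B_n = H_n - (1 - P^{ZXZ}_1) - (1 - P^{ZXZ}_n)` (both boundary terms removed). -/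
def HhamB (n : ℕ) (hn : 0 < n) :
    Matrix ((Fin 2 → (Fin n → Fin 2)) × (Fin 2 → (Fin n → Fin 2)))
           ((Fin 2 → (Fin n → Fin 2)) × (Fin 2 → (Fin n → Fin 2))) ℂ :=
  HhamL n hn - (1 - Pproj (ZXZop (⟨0, hn⟩ : Fin n)))

/-- `ψ₀ = ½(|0000⟩+|0101⟩+|1010⟩+|1111⟩)` in `(ℂ²)^{⊗4}`. -/
def psi0 : (Fin 4 → Fin 2) → ℂ :=
  fun b => if b 0 = b 2 ∧ b 1 = b 3 then (1 / 2 : ℂ) else 0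
/-- `ψ₁ = ½(|0000⟩+|0110⟩+|1001⟩+|1111⟩)` in `(ℂ²)^{⊗4}`. -/
def psi1 : (Fin 4 → Fin 2) → ℂ :=
  fun b => if b 0 = b 3 ∧ b 1 = b 2 then (1 / 2 : ℂ) else 0
/-- `ψ_φ = ψ₀ - ψ₁`. -/
def psiphi : (Fin 4 → Fin 2) → ℂ := psi0 - psi1

/-- The image under the canonical tensor-factor permutation
`Θ : ((ℂ²)^{⊗4})^{⊗n} → ((ℂ²)^{⊗n})^{⊗4}` of the product vector `ψ^{⊗n}`:
the four copies of qubit `i` are `(p.1 0 i, p.1 1 i, p.2 0 i, p.2 1 i)`. -/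
def gvec (n : ℕ) (ψ : (Fin 4 → Fin 2) → ℂ) :
    ((Fin 2 → (Fin n → Fin 2)) × (Fin 2 → (Fin n → Fin 2))) → ℂ :=
  fun p => ∏ i : Fin n, ψ ![p.1 0 i, p.1 1 i, p.2 0 i, p.2 1 i]


section Exponential

variable {d : Type*} [Fintype d] [DecidableEq d]

/-- For an involution `A`, the exponential `e^{zA}` equals `cosh z + sinh z • A`. -/
theorem mexp_smul_of_mul_self_eq_one {A : Matrix d d ℂ} (hA : A * A = 1) (z : ℂ) :
    mexp (z • A) = Complex.cosh z • (1 : Matrix d d ℂ) + Complex.sinh z • A := by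
  have hpow : ∀ k : ℕ, ((k.factorial : ℂ))⁻¹ • (z • A) ^ k =
      ((z ^ k / k.factorial + (-z) ^ k / k.factorial) / 2) • (1 : Matrix d d ℂ) +
        ((z ^ k / k.factorial - (-z) ^ k / k.factorial) / 2) • A := by
    intro k
    rcases Nat.even_or_odd' k with ⟨m, rfl | rfl⟩
    · have h1 : A ^ (2 * m) = 1 := by rw [pow_mul, pow_two, hA, one_pow]
      have h2 : (-z) ^ (2 * m) = z ^ (2 * m) := by rw [pow_mul, pow_mul, neg_sq]
      rw [smul_pow, h1, h2, smul_smul]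
      module
    · have h1 : A ^ (2 * m + 1) = A := by rw [pow_succ, pow_mul, pow_two, hA, one_pow, one_mul]
      have h2 : (-z) ^ (2 * m + 1) = -z ^ (2 * m + 1) := by
        rw [pow_succ, pow_mul, neg_sq, ← pow_mul, pow_succ]; ring
      rw [smul_pow, h1, h2, smul_smul]
      module
  have hs : ∀ w : ℂ, HasSum (fun k : ℕ => w ^ k / (k.factorial : ℂ)) (Complex.exp w) := by
    intro w
    rw [Complex.exp_eq_exp_ℂ]
    exact NormedSpace.expSeries_div_hasSum_exp w
  have h1 := (((hs z).add (hs (-z))).div_const 2).smul_const (1 : Matrix d d ℂ)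
  have h2 := (((hs z).sub (hs (-z))).div_const 2).smul_const A
  unfold mexp
  simp_rw [hpow]
  exact (h1.add h2).tsum_eq

theorem rotGate_eq {n : ℕ} {A : QMat n} (hA : A * A = 1) (φ : ℝ) :
    rotGate φ A = (Real.cos φ : ℂ) • (1 : QMat n) + (Complex.I * (Real.sin φ : ℂ)) • A := by
  rw [rotGate, mexp_smul_of_mul_self_eq_one hA, mul_comm Complex.I, Complex.cosh_mul_I,
    Complex.sinh_mul_I, Complex.ofReal_cos, Complex.ofReal_sin, mul_comm Complex.I]

end Exponential

section FourfoldKronecker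

variable {d : Type*}

/-- `A ⊗ B ⊗ C ⊗ D` on the index type used for `(ℂ^d)^{⊗4}`. -/
def kron4 (A B C D : Matrix d d ℂ) :
    Matrix ((Fin 2 → d) × (Fin 2 → d)) ((Fin 2 → d) × (Fin 2 → d)) ℂ :=
  (kronecker (kronecker A B) (kronecker C D)).submatrix
    ((finTwoArrowEquiv d).prodCongr (finTwoArrowEquiv d))
    ((finTwoArrowEquiv d).prodCongr (finTwoArrowEquiv d))

theorem kron4_apply (A B C D : Matrix d d ℂ) (x y : (Fin 2 → d) × (Fin 2 → d)) :
    kron4 A B C D x y =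
      A (x.1 0) (y.1 0) * B (x.1 1) (y.1 1) * (C (x.2 0) (y.2 0) * D (x.2 1) (y.2 1)) :=
  rfl

theorem kron4_mul [Fintype d] (A B C D A' B' C' D' : Matrix d d ℂ) :
    kron4 A B C D * kron4 A' B' C' D' = kron4 (A * A') (B * B') (C * C') (D * D') := by
  simp only [kron4, submatrix_mul_equiv, kronecker, Matrix.mul_kronecker_mul]

theorem kron4_one [DecidableEq d] : kron4 (1 : Matrix d d ℂ) 1 1 1 = 1 := by
  simp only [kron4, kronecker, Matrix.one_kronecker_one, submatrix_one_equiv]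

theorem conjTranspose_kron4 (A B C D : Matrix d d ℂ) :
    (kron4 A B C D)ᴴ = kron4 Aᴴ Bᴴ Cᴴ Dᴴ := by
  simp only [kron4, kronecker, conjTranspose_submatrix, Matrix.conjTranspose_kronecker]

variable [DecidableEq d]

/-- The generator `A₁ + A₂ - A₃ - A₄` of the one-parameter group `(e^{iφA})^{⊗2,2}`
for a real matrix `A`. -/
def gen4 (A : Matrix d d ℂ) :
    Matrix ((Fin 2 → d) × (Fin 2 → d)) ((Fin 2 → d) × (Fin 2 → d)) ℂ :=
  kron4 A 1 1 1 + kron4 1 A 1 1 - kron4 1 1 A 1 - kron4 1 1 1 A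

/-- The spectral projection of `gen4 A` onto its kernel, for an involution `A`. -/
def proj4 (A : Matrix d d ℂ) :
    Matrix ((Fin 2 → d) × (Fin 2 → d)) ((Fin 2 → d) × (Fin 2 → d)) ℂ :=
  (8 : ℂ)⁻¹ • ((3 : ℂ) • kron4 1 1 1 1 + (3 : ℂ) • kron4 A A A A - kron4 A A 1 1 -
    kron4 1 1 A A + kron4 A 1 A 1 + kron4 A 1 1 A + kron4 1 A A 1 + kron4 1 A 1 A)

variable [Fintype d] {A : Matrix d d ℂ}

theorem gen4_mul_proj4 (hA : A * A = 1) : gen4 A * proj4 A = 0 := by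
  simp only [gen4, proj4, mul_smul_comm, sub_mul, add_mul, mul_sub, mul_add, kron4_mul, hA,
    one_mul, mul_one]
  module

theorem proj4_mul_self (hA : A * A = 1) : proj4 A * proj4 A = proj4 A := by
  simp only [proj4, mul_smul_comm, smul_mul_assoc, sub_mul, add_mul, mul_sub, mul_add, kron4_mul,
    hA, one_mul, mul_one]
  module

theorem gen4_mul_self (hA : A * A = 1) : gen4 A * gen4 A =
    (4 : ℂ) • kron4 1 1 1 1 + (2 : ℂ) • (kron4 A A 1 1 + kron4 1 1 A A - kron4 A 1 A 1 -
      kron4 A 1 1 A - kron4 1 A A 1 - kron4 1 A 1 A) := by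
  simp only [gen4, sub_mul, add_mul, mul_sub, mul_add, kron4_mul, hA, one_mul, mul_one]
  module

theorem one_sub_proj4 (hA : A * A = 1) :
    1 - proj4 A = ((5 / 16 : ℂ) • 1 - (1 / 64 : ℂ) • (gen4 A * gen4 A)) * (gen4 A * gen4 A) := by
  rw [gen4_mul_self hA, ← kron4_one]
  simp only [proj4, mul_smul_comm, smul_mul_assoc, sub_mul, add_mul, mul_sub, mul_add, kron4_mul,
    hA, one_mul, mul_one, smul_add, smul_sub]
  module

theorem one_sub_proj4_mulVec_eq_zero_iff (hA : A * A = 1)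
    (v : (Fin 2 → d) × (Fin 2 → d) → ℂ) :
    (1 - proj4 A) *ᵥ v = 0 ↔ gen4 A *ᵥ v = 0 := by
  constructor
  · intro h
    have h1 : v = proj4 A *ᵥ v := by
      rwa [sub_mulVec, one_mulVec, sub_eq_zero] at h
    rw [h1, mulVec_mulVec, gen4_mul_proj4 hA, zero_mulVec]
  · intro h
    rw [one_sub_proj4 hA, ← mulVec_mulVec, ← mulVec_mulVec, h, mulVec_zero, mulVec_zero]

theorem posSemidef_one_sub_proj4 (hA : A * A = 1) (hA' : Aᴴ = A) :
    (1 - proj4 A).PosSemidef := by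
  have hP : (proj4 A)ᴴ = proj4 A := by
    simp [proj4, conjTranspose_kron4, hA']
  have h : 1 - proj4 A = (1 - proj4 A)ᴴ * (1 - proj4 A) := by
    rw [conjTranspose_sub, conjTranspose_one, hP, sub_mul, one_mul, mul_sub, mul_one,
      proj4_mul_self hA, sub_self, sub_zero]
  rw [h]
  exact posSemidef_conjTranspose_mul_self _

end FourfoldKronecker

section Averages

theorem integral_cos_pow_four : ∫ φ in (0 : ℝ)..(2 * π), Real.cos φ ^ 4 = 2 * π * (3 / 8) := by
  rw [integral_cos_pow]
  norm_num
  ring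

theorem integral_sin_pow_four : ∫ φ in (0 : ℝ)..(2 * π), Real.sin φ ^ 4 = 2 * π * (3 / 8) := by
  rw [integral_sin_pow]
  norm_num
  ring

theorem integral_cos_sq_mul_sin_sq :
    ∫ φ in (0 : ℝ)..(2 * π), Real.cos φ ^ 2 * Real.sin φ ^ 2 = 2 * π * (1 / 8) := by
  simp_rw [mul_comm (Real.cos _ ^ 2)]
  rw [integral_sin_sq_mul_cos_sq, show 4 * (2 * π) = (8 : ℕ) * π by push_cast; ring,
    Real.sin_nat_mul_pi]
  norm_num
  ring

theorem integral_cos_pow_three_mul_sin :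
    ∫ φ in (0 : ℝ)..(2 * π), Real.cos φ ^ 3 * Real.sin φ = 0 := by
  have h := integral_sin_pow_odd_mul_cos_pow (a := 0) (b := 2 * π) 0 3
  simp only [mul_zero, zero_add, pow_one, Real.cos_zero, Real.cos_two_pi,
    intervalIntegral.integral_same] at h
  simpa only [mul_comm] using h

theorem integral_cos_mul_sin_pow_three :
    ∫ φ in (0 : ℝ)..(2 * π), Real.cos φ * Real.sin φ ^ 3 = 0 := by
  have h := integral_sin_pow_mul_cos_pow_odd (a := 0) (b := 2 * π) 3 0
  simp only [mul_zero, zero_add, pow_one, Real.sin_zero, Real.sin_two_pi,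
    intervalIntegral.integral_same] at h
  simpa only [mul_comm] using h

theorem integral_quartic_cos_sin (a b c e f : ℂ) :
    ∫ φ in (0 : ℝ)..(2 * π),
        (((Real.cos φ ^ 4 : ℝ) : ℂ) * a + ((Real.cos φ ^ 3 * Real.sin φ : ℝ) : ℂ) * b +
          ((Real.cos φ ^ 2 * Real.sin φ ^ 2 : ℝ) : ℂ) * c +
          ((Real.cos φ * Real.sin φ ^ 3 : ℝ) : ℂ) * e + ((Real.sin φ ^ 4 : ℝ) : ℂ) * f) =
      ((2 * π : ℝ) : ℂ) * (3 / 8 * a + 1 / 8 * c + 3 / 8 * f) := by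
  have hi : ∀ (g : ℝ → ℝ) (z : ℂ), Continuous g →
      IntervalIntegrable (fun φ => (g φ : ℂ) * z) volume 0 (2 * π) := fun g z hg =>
    Continuous.intervalIntegrable (by fun_prop) _ _
  have h4 := hi (fun φ => Real.cos φ ^ 4) a (by fun_prop)
  have h3 := hi (fun φ => Real.cos φ ^ 3 * Real.sin φ) b (by fun_prop)
  have h2 := hi (fun φ => Real.cos φ ^ 2 * Real.sin φ ^ 2) c (by fun_prop)
  have h1 := hi (fun φ => Real.cos φ * Real.sin φ ^ 3) e (by fun_prop)
  have h0 := hi (fun φ => Real.sin φ ^ 4) f (by fun_prop)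
  rw [intervalIntegral.integral_add (((h4.add h3).add h2).add h1) h0,
    intervalIntegral.integral_add ((h4.add h3).add h2) h1,
    intervalIntegral.integral_add (h4.add h3) h2, intervalIntegral.integral_add h4 h3]
  simp only [intervalIntegral.integral_mul_const, intervalIntegral.integral_ofReal,
    integral_cos_pow_four, integral_cos_pow_three_mul_sin, integral_cos_sq_mul_sin_sq,
    integral_cos_mul_sin_pow_three, integral_sin_pow_four]
  push_cast
  ring

theorem Pproj_eq_proj4 {n : ℕ} {A : QMat n} (hA : A * A = 1)
    (hr : ∀ x y, conj (A x y) = A x y) : Pproj A = proj4 A := by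
  ext x y
  have hone : ∀ a b, conj ((1 : QMat n) a b) = (1 : QMat n) a b := fun a b => by
    rw [Matrix.one_apply]; split_ifs <;> simp
  have hI3 : Complex.I ^ 3 = -Complex.I := by
    rw [pow_succ, Complex.I_sq, neg_one_mul]
  simp only [Pproj, of_apply, tpow2, rotGate_eq hA, Fin.prod_univ_two, Matrix.add_apply,
    Matrix.smul_apply, smul_eq_mul, map_add, map_mul, hr, hone, Complex.conj_ofReal,
    Complex.conj_I]
  generalize e0 : (1 : QMat n) (x.1 0) (y.1 0) = δ₀
  generalize e1 : (1 : QMat n) (x.1 1) (y.1 1) = δ₁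
  generalize e2 : (1 : QMat n) (x.2 0) (y.2 0) = δ₂
  generalize e3 : (1 : QMat n) (x.2 1) (y.2 1) = δ₃
  generalize f0 : A (x.1 0) (y.1 0) = a₀
  generalize f1 : A (x.1 1) (y.1 1) = a₁
  generalize f2 : A (x.2 0) (y.2 0) = a₂
  generalize f3 : A (x.2 1) (y.2 1) = a₃
  have hpi : ((2 * π : ℝ) : ℂ) ≠ 0 := by
    exact_mod_cast Real.two_pi_pos.ne'
  have key := integral_quartic_cos_sin (δ₀ * δ₁ * δ₂ * δ₃)
    (Complex.I * (a₀ * δ₁ * δ₂ * δ₃ + δ₀ * a₁ * δ₂ * δ₃ - δ₀ * δ₁ * a₂ * δ₃ - δ₀ * δ₁ * δ₂ * a₃))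
    (-(a₀ * a₁ * δ₂ * δ₃) - δ₀ * δ₁ * a₂ * a₃ + a₀ * δ₁ * a₂ * δ₃ + a₀ * δ₁ * δ₂ * a₃ +
      δ₀ * a₁ * a₂ * δ₃ + δ₀ * a₁ * δ₂ * a₃)
    (Complex.I * (a₀ * a₁ * a₂ * δ₃ + a₀ * a₁ * δ₂ * a₃ - a₀ * δ₁ * a₂ * a₃ - δ₀ * a₁ * a₂ * a₃))
    (a₀ * a₁ * a₂ * a₃)
  calc _ = ((2 * π : ℝ) : ℂ)⁻¹ * (((2 * π : ℝ) : ℂ) * _) := by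
        rw [← key]
        congr 1
        refine intervalIntegral.integral_congr fun φ _ => ?_
        push_cast
        ring_nf
        simp only [Complex.I_sq, hI3, Complex.I_pow_four]
        ring
    _ = _ := by
        rw [inv_mul_cancel_left₀ hpi]
        simp only [proj4, Matrix.smul_apply, Matrix.add_apply, Matrix.sub_apply, kron4_apply,
          smul_eq_mul, e0, e1, e2, e3, f0, f1, f2, f3]
        ring

end Averages

section Monomial

variable {d : Type*} [DecidableEq d]

/-- The matrix acting on functions by `(A v) x = σ x * v (τ x)`. -/
def monomialMat (σ : d → ℂ) (τ : d → d) : Matrix d d ℂ :=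
  Matrix.of fun x y => if y = τ x then σ x else 0

theorem monomialMat_one : monomialMat (fun _ => (1 : ℂ)) (fun x : d => x) = 1 := by
  ext x y
  simp [monomialMat, Matrix.one_apply, eq_comm]

theorem monomialMat_mul_self [Fintype d] {σ : d → ℂ} {τ : d → d} (hτ : ∀ x, τ (τ x) = x)
    (hσ : ∀ x, σ x * σ (τ x) = 1) : monomialMat σ τ * monomialMat σ τ = 1 := by
  ext x y
  rw [Matrix.mul_apply, Finset.sum_eq_single (τ x)]
  · simp [monomialMat, Matrix.one_apply, hτ, hσ, eq_comm]
  · intro z _ hz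
    simp [monomialMat, hz]
  · simp

theorem conjTranspose_monomialMat {σ : d → ℂ} {τ : d → d} (hτ : ∀ x, τ (τ x) = x)
    (hσ : ∀ x, σ (τ x) = σ x) (hr : ∀ x, conj (σ x) = σ x) :
    (monomialMat σ τ)ᴴ = monomialMat σ τ := by
  ext x y
  have h : x = τ y ↔ y = τ x :=
    ⟨fun h => by rw [h, hτ], fun h => by rw [h, hτ]⟩
  simp only [conjTranspose_apply, monomialMat, of_apply, h]
  split_ifs with hy
  · rw [← starRingEnd_apply, hr, hy, hσ]
  · simp

theorem conj_monomialMat_apply {σ : d → ℂ} {τ : d → d} (hr : ∀ x, conj (σ x) = σ x) (x y : d) :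
    conj (monomialMat σ τ x y) = monomialMat σ τ x y := by
  simp only [monomialMat, of_apply]
  split_ifs <;> simp [hr]

theorem kron4_monomialMat_mulVec [Fintype d] (σ₀ σ₁ σ₂ σ₃ : d → ℂ) (τ₀ τ₁ τ₂ τ₃ : d → d)
    (v : (Fin 2 → d) × (Fin 2 → d) → ℂ) (a b c e : d) :
    (kron4 (monomialMat σ₀ τ₀) (monomialMat σ₁ τ₁) (monomialMat σ₂ τ₂) (monomialMat σ₃ τ₃) *ᵥ v)
        (![a, b], ![c, e]) =
      σ₀ a * σ₁ b * (σ₂ c * σ₃ e) * v (![τ₀ a, τ₁ b], ![τ₂ c, τ₃ e]) := by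
  rw [mulVec, dotProduct, Finset.sum_eq_single (![τ₀ a, τ₁ b], ![τ₂ c, τ₃ e])]
  · simp [kron4_apply, monomialMat]
  · rintro ⟨y, z⟩ - hne
    have hyz : ¬(y 0 = τ₀ a ∧ y 1 = τ₁ b ∧ z 0 = τ₂ c ∧ z 1 = τ₃ e) := by
      rintro ⟨h0, h1, h2, h3⟩
      refine hne (Prod.ext ?_ ?_) <;> funext i <;> fin_cases i <;> simp [h0, h1, h2, h3]
    simp only [kron4_apply, monomialMat, of_apply, Matrix.cons_val_zero, Matrix.cons_val_one]
    split_ifs <;> simp_all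
  · simp

theorem gen4_monomialMat_mulVec [Fintype d] (σ : d → ℂ) (τ : d → d)
    (v : (Fin 2 → d) × (Fin 2 → d) → ℂ) (a b c e : d) :
    (gen4 (monomialMat σ τ) *ᵥ v) (![a, b], ![c, e]) =
      σ a * v (![τ a, b], ![c, e]) + σ b * v (![a, τ b], ![c, e]) -
        σ c * v (![a, b], ![τ c, e]) - σ e * v (![a, b], ![c, τ e]) := by
  simp only [gen4, sub_mulVec, add_mulVec, Pi.sub_apply, Pi.add_apply, ← monomialMat_one,
    kron4_monomialMat_mulVec, one_mul, mul_one]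

end Monomial

section Pauli

/-- The eigenvalue of the Pauli matrix `Z` on a computational basis vector. -/
def zSign (b : Fin 2) : ℂ := if b = 0 then 1 else -1

/-- Flip the `i`-th bit of a bit string. -/
def bitFlip {ι : Type*} [DecidableEq ι] (i : ι) (x : ι → Fin 2) : ι → Fin 2 :=
  Function.update x i (x i + 1)

theorem bitFlip_bitFlip {ι : Type*} [DecidableEq ι] (i : ι) (x : ι → Fin 2) :
    bitFlip i (bitFlip i x) = x := by
  have h : ∀ b : Fin 2, b + 1 + 1 = b := by decide
  simp [bitFlip, h]

theorem bitFlip_of_ne {ι : Type*} [DecidableEq ι] {i j : ι} (h : j ≠ i) (x : ι → Fin 2) :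
    bitFlip i x j = x j := Function.update_of_ne h _ _

theorem zSign_mul_self (b : Fin 2) : zSign b * zSign b = 1 := by
  unfold zSign; split_ifs <;> simp

theorem conj_zSign (b : Fin 2) : conj (zSign b) = zSign b := by
  unfold zSign; split_ifs <;> simp

variable {n : ℕ}

theorem op1_apply (i : Fin n) (A : Matrix (Fin 2) (Fin 2) ℂ) (x y : Fin n → Fin 2) :
    op1 i A x y = if ∀ j, j ≠ i → x j = y j then A (x i) (y i) else 0 := by
  simp only [op1, of_apply]
  split_ifs with h
  · rw [Finset.prod_eq_one, mul_one]
    intro j hj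
    rw [if_pos (h j (Finset.ne_of_mem_erase hj))]
  · push Not at h
    obtain ⟨j, hj, hxy⟩ := h
    rw [Finset.prod_eq_zero (Finset.mem_erase.2 ⟨hj, Finset.mem_univ j⟩) (if_neg hxy), mul_zero]

theorem Xop_eq (i : Fin n) : Xop i = monomialMat (fun _ => 1) (bitFlip i) := by
  ext x y
  have h : y = bitFlip i x ↔ (∀ j, j ≠ i → x j = y j) ∧ y i = x i + 1 := by
    rw [bitFlip, Function.eq_update_iff, and_comm]
    simp only [eq_comm]
  have hX : ∀ a b : Fin 2, pauliX a b = if b = a + 1 then 1 else 0 := by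
    intro a b
    fin_cases a <;> fin_cases b <;> simp [pauliX]
  simp only [Xop, op1_apply, monomialMat, of_apply, h, hX, ite_and]

theorem Zop_eq_diagonal (i : Fin n) : Zop i = diagonal fun x => zSign (x i) := by
  ext x y
  have hZ : ∀ a b : Fin 2, pauliZ a b = if a = b then zSign a else 0 := by
    intro a b
    fin_cases a <;> fin_cases b <;> simp [pauliZ, zSign]
  have h : x = y ↔ (∀ j, j ≠ i → x j = y j) ∧ x i = y i :=
    ⟨fun h => by simp [h], fun h => funext fun j => by
      by_cases hj : j = i
      · rw [hj, h.2]
      · exact h.1 j hj⟩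
  simp only [Zop, op1_apply, diagonal_apply, h, hZ, ite_and]

theorem Zop_eq (i : Fin n) : Zop i = monomialMat (fun x => zSign (x i)) (fun x => x) := by
  rw [Zop_eq_diagonal]
  ext x y
  simp [monomialMat, diagonal_apply, eq_comm]

/-- The sign by which the `Z` factors of `ZXZop i` act on a basis vector. -/
def zxzSign (i : Fin n) (x : Fin n → Fin 2) : ℂ :=
  (if h : 0 < (i : ℕ) then zSign (x ⟨(i : ℕ) - 1, by have := i.isLt; omega⟩) else 1) *
    (if h : (i : ℕ) + 1 < n then zSign (x ⟨(i : ℕ) + 1, h⟩) else 1)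

theorem zxzSign_bitFlip (i : Fin n) (x : Fin n → Fin 2) :
    zxzSign i (bitFlip i x) = zxzSign i x := by
  unfold zxzSign
  congr 1
  · refine dite_congr rfl (fun h => ?_) fun _ => rfl
    rw [bitFlip_of_ne]
    simp only [ne_eq, Fin.ext_iff]
    omega
  · refine dite_congr rfl (fun h => ?_) fun _ => rfl
    rw [bitFlip_of_ne]
    simp only [ne_eq, Fin.ext_iff]
    omega

theorem zxzSign_mul_self (i : Fin n) (x : Fin n → Fin 2) : zxzSign i x * zxzSign i x = 1 := by
  unfold zxzSign
  rw [mul_mul_mul_comm]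
  split_ifs <;> simp [zSign_mul_self]

theorem conj_zxzSign (i : Fin n) (x : Fin n → Fin 2) : conj (zxzSign i x) = zxzSign i x := by
  unfold zxzSign
  split_ifs <;> simp [conj_zSign]

theorem ZXZop_eq (i : Fin n) : ZXZop i = monomialMat (zxzSign i) (bitFlip i) := by
  have hl : (if h : 0 < (i : ℕ) then Zop ⟨(i : ℕ) - 1, by have := i.isLt; omega⟩ else 1) =
      diagonal fun x : Fin n → Fin 2 =>
        if h : 0 < (i : ℕ) then zSign (x ⟨(i : ℕ) - 1, by have := i.isLt; omega⟩) else 1 := by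
    split_ifs
    · exact Zop_eq_diagonal _
    · exact diagonal_one.symm
  have hr : (if h : (i : ℕ) + 1 < n then Zop ⟨(i : ℕ) + 1, h⟩ else 1) =
      diagonal fun x : Fin n → Fin 2 =>
        if h : (i : ℕ) + 1 < n then zSign (x ⟨(i : ℕ) + 1, h⟩) else 1 := by
    split_ifs
    · exact Zop_eq_diagonal _
    · exact diagonal_one.symm
  ext x y
  rw [ZXZop, hl, hr, mul_diagonal, diagonal_mul, Xop_eq]
  simp only [monomialMat, of_apply]
  by_cases hy : y = bitFlip i x
  · rw [if_pos hy, if_pos hy, mul_one, zxzSign]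
    congr 1
    refine dite_congr rfl (fun h => ?_) fun _ => rfl
    rw [hy, bitFlip_of_ne]
    simp only [ne_eq, Fin.ext_iff]
    omega
  · rw [if_neg hy, if_neg hy, mul_zero, zero_mul]

end Pauli

section Hamiltonian

variable {n : ℕ}

/-- `∑ᵢ (1 - P^X_i) + ∑ᵢ (1 - P^Z_i) + ∑_{i ∈ S} (1 - P^{ZXZ}_i)`. -/
def HhamOn (S : Finset (Fin n)) :
    Matrix ((Fin 2 → (Fin n → Fin 2)) × (Fin 2 → (Fin n → Fin 2)))
           ((Fin 2 → (Fin n → Fin 2)) × (Fin 2 → (Fin n → Fin 2))) ℂ :=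
  (∑ i : Fin n, (1 - Pproj (Xop i))) + (∑ i : Fin n, (1 - Pproj (Zop i))) +
    (∑ i ∈ S, (1 - Pproj (ZXZop i)))

theorem Hham_eq : Hham n = HhamOn (Finset.univ : Finset (Fin n)) := rfl

theorem HhamL_eq (hn : 0 < n) :
    HhamL n hn = HhamOn (Finset.univ.erase (⟨n - 1, by omega⟩ : Fin n)) := by
  rw [HhamL, Hham, HhamOn, Finset.sum_erase_eq_sub (Finset.mem_univ _), add_sub_assoc]

theorem HhamB_eq (hn : 1 < n) :
    HhamB n (by omega) =
      HhamOn ((Finset.univ.erase (⟨n - 1, by omega⟩ : Fin n)).erase ⟨0, by omega⟩) := by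
  have h : (⟨0, by omega⟩ : Fin n) ∈ Finset.univ.erase (⟨n - 1, by omega⟩ : Fin n) := by
    simp only [Finset.mem_erase, Finset.mem_univ, and_true, ne_eq, Fin.mk.injEq]
    omega
  rw [HhamB, HhamL_eq, HhamOn, HhamOn, Finset.sum_erase_eq_sub h, add_sub_assoc]

theorem Xop_mul_self (i : Fin n) : Xop i * Xop i = 1 := by
  rw [Xop_eq]
  exact monomialMat_mul_self (bitFlip_bitFlip i) fun _ => one_mul 1

theorem Zop_mul_self (i : Fin n) : Zop i * Zop i = 1 := by
  rw [Zop_eq]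
  exact monomialMat_mul_self (fun _ => rfl) fun x => zSign_mul_self _

theorem ZXZop_mul_self (i : Fin n) : ZXZop i * ZXZop i = 1 := by
  rw [ZXZop_eq]
  exact monomialMat_mul_self (bitFlip_bitFlip i) fun x => by
    rw [zxzSign_bitFlip, zxzSign_mul_self]

theorem posSemidef_add_mulVec_eq_zero_iff {m : Type*} [Fintype m] {M N : Matrix m m ℂ}
    (hM : M.PosSemidef) (hN : N.PosSemidef) (v : m → ℂ) :
    (M + N) *ᵥ v = 0 ↔ M *ᵥ v = 0 ∧ N *ᵥ v = 0 := by
  rw [← (hM.add hN).dotProduct_mulVec_zero_iff, ← hM.dotProduct_mulVec_zero_iff,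
    ← hN.dotProduct_mulVec_zero_iff, add_mulVec, dotProduct_add]
  exact add_eq_zero_iff_of_nonneg (hM.dotProduct_mulVec_nonneg v) (hN.dotProduct_mulVec_nonneg v)

theorem posSemidef_sum_mulVec_eq_zero_iff {m ι : Type*} [Fintype m] (s : Finset ι)
    {M : ι → Matrix m m ℂ} (hM : ∀ i, (M i).PosSemidef) (v : m → ℂ) :
    (∑ i ∈ s, M i) *ᵥ v = 0 ↔ ∀ i ∈ s, M i *ᵥ v = 0 := by
  classical
  induction s using Finset.induction_on with
  | empty => simp
  | insert a s ha ih =>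
    rw [Finset.sum_insert ha, posSemidef_add_mulVec_eq_zero_iff (hM a)
      (posSemidef_sum s fun i _ => hM i), ih, Finset.forall_mem_insert]

theorem mem_ker_HhamOn_iff (S : Finset (Fin n))
    (v : (Fin 2 → (Fin n → Fin 2)) × (Fin 2 → (Fin n → Fin 2)) → ℂ) :
    v ∈ LinearMap.ker (Matrix.toLin' (HhamOn S)) ↔
      (∀ i, gen4 (Xop i) *ᵥ v = 0) ∧ (∀ i, gen4 (Zop i) *ᵥ v = 0) ∧
        ∀ i ∈ S, gen4 (ZXZop i) *ᵥ v = 0 := by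
  have hX : ∀ i : Fin n, Pproj (Xop i) = proj4 (Xop i) := fun i =>
    Pproj_eq_proj4 (Xop_mul_self i) <| by
      rw [Xop_eq]; exact conj_monomialMat_apply fun _ => map_one _
  have hZ : ∀ i : Fin n, Pproj (Zop i) = proj4 (Zop i) := fun i =>
    Pproj_eq_proj4 (Zop_mul_self i) <| by
      rw [Zop_eq]; exact conj_monomialMat_apply fun _ => conj_zSign _
  have hZXZ : ∀ i : Fin n, Pproj (ZXZop i) = proj4 (ZXZop i) := fun i =>
    Pproj_eq_proj4 (ZXZop_mul_self i) <| by
      rw [ZXZop_eq]; exact conj_monomialMat_apply fun _ => conj_zxzSign _ _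
  have pX : ∀ i : Fin n, (1 - proj4 (Xop i)).PosSemidef := fun i =>
    posSemidef_one_sub_proj4 (Xop_mul_self i) <| by
      rw [Xop_eq]
      exact conjTranspose_monomialMat (bitFlip_bitFlip i) (fun _ => rfl) fun _ => map_one _
  have pZ : ∀ i : Fin n, (1 - proj4 (Zop i)).PosSemidef := fun i =>
    posSemidef_one_sub_proj4 (Zop_mul_self i) <| by
      rw [Zop_eq]
      exact conjTranspose_monomialMat (fun _ => rfl) (fun _ => rfl) fun _ => conj_zSign _
  have pZXZ : ∀ i : Fin n, (1 - proj4 (ZXZop i)).PosSemidef := fun i =>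
    posSemidef_one_sub_proj4 (ZXZop_mul_self i) <| by
      rw [ZXZop_eq]
      exact conjTranspose_monomialMat (bitFlip_bitFlip i) (zxzSign_bitFlip i)
        fun _ => conj_zxzSign _ _
  rw [LinearMap.mem_ker, Matrix.toLin'_apply, HhamOn]
  simp only [hX, hZ, hZXZ]
  rw [posSemidef_add_mulVec_eq_zero_iff
      ((posSemidef_sum _ fun i _ => pX i).add (posSemidef_sum _ fun i _ => pZ i))
      (posSemidef_sum _ fun i _ => pZXZ i),
    posSemidef_add_mulVec_eq_zero_iff (posSemidef_sum _ fun i _ => pX i)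
      (posSemidef_sum _ fun i _ => pZ i),
    posSemidef_sum_mulVec_eq_zero_iff _ pX, posSemidef_sum_mulVec_eq_zero_iff _ pZ,
    posSemidef_sum_mulVec_eq_zero_iff _ pZXZ]
  simp only [one_sub_proj4_mulVec_eq_zero_iff (Xop_mul_self _),
    one_sub_proj4_mulVec_eq_zero_iff (Zop_mul_self _),
    one_sub_proj4_mulVec_eq_zero_iff (ZXZop_mul_self _), Finset.mem_univ, true_imp_iff, and_assoc]

end Hamiltonian

section SiteMajor

variable {n : ℕ}

/-- The basis label of `((ℂ²)^{⊗n})^{⊗4}` obtained from the four bits on every site. -/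
def copies (q : Fin n → Fin 4 → Fin 2) : (Fin 2 → (Fin n → Fin 2)) × (Fin 2 → (Fin n → Fin 2)) :=
  (![fun i => q i 0, fun i => q i 1], ![fun i => q i 2, fun i => q i 3])

theorem copies_surjective : Function.Surjective (copies (n := n)) := by
  rintro ⟨x, y⟩
  refine ⟨fun i => ![x 0 i, x 1 i, y 0 i, y 1 i], Prod.ext ?_ ?_⟩ <;>
    funext k <;> fin_cases k <;> rfl

theorem gvec_copies (ψ : (Fin 4 → Fin 2) → ℂ) (q : Fin n → Fin 4 → Fin 2) :
    gvec n ψ (copies q) = ∏ i, ψ (q i) := by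
  refine Finset.prod_congr rfl fun i _ => congrArg ψ ?_
  funext k
  fin_cases k <;> rfl

/-- The sign of the `k`-th copy in `A₁ + A₂ - A₃ - A₄`. -/
def copySign : Fin 4 → ℂ := ![1, 1, -1, -1]

/-- Flip the bit of copy `k` on site `i`. -/
def flipAt (q : Fin n → Fin 4 → Fin 2) (i : Fin n) (k : Fin 4) : Fin n → Fin 4 → Fin 2 :=
  Function.update q i (bitFlip k (q i))

theorem flipAt_copy (q : Fin n → Fin 4 → Fin 2) (i : Fin n) (k l : Fin 4) :
    (fun j => flipAt q i k j l) =
      if l = k then bitFlip i (fun j => q j l) else fun j => q j l := by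
  funext j
  by_cases hj : j = i <;> by_cases hl : l = k <;> simp [flipAt, bitFlip, hj, hl]

theorem gen4_flip_mulVec (σ : (Fin n → Fin 2) → ℂ) (i : Fin n)
    (v : (Fin 2 → (Fin n → Fin 2)) × (Fin 2 → (Fin n → Fin 2)) → ℂ)
    (q : Fin n → Fin 4 → Fin 2) :
    (gen4 (monomialMat σ (bitFlip i)) *ᵥ v) (copies q) =
      ∑ k, copySign k * (σ (fun j => q j k) * v (copies (flipAt q i k))) := by
  rw [copies, gen4_monomialMat_mulVec]
  simp [Fin.sum_univ_four, copySign, copies, flipAt_copy]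
  ring

theorem gen4_Zop_mulVec (i : Fin n)
    (v : (Fin 2 → (Fin n → Fin 2)) × (Fin 2 → (Fin n → Fin 2)) → ℂ)
    (q : Fin n → Fin 4 → Fin 2) :
    (gen4 (Zop i) *ᵥ v) (copies q) = (∑ k, copySign k * zSign (q i k)) * v (copies q) := by
  rw [Zop_eq, copies, gen4_monomialMat_mulVec]
  simp [Fin.sum_univ_four, copySign]
  ring

theorem gen4_Xop_mulVec (i : Fin n)
    (v : (Fin 2 → (Fin n → Fin 2)) × (Fin 2 → (Fin n → Fin 2)) → ℂ)
    (q : Fin n → Fin 4 → Fin 2) :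
    (gen4 (Xop i) *ᵥ v) (copies q) = ∑ k, copySign k * v (copies (flipAt q i k)) := by
  rw [Xop_eq, gen4_flip_mulVec]
  simp only [one_mul]

theorem gen4_ZXZop_mulVec (i : Fin n)
    (v : (Fin 2 → (Fin n → Fin 2)) × (Fin 2 → (Fin n → Fin 2)) → ℂ)
    (q : Fin n → Fin 4 → Fin 2) :
    (gen4 (ZXZop i) *ᵥ v) (copies q) =
      ∑ k, copySign k * (zxzSign i (fun j => q j k) * v (copies (flipAt q i k))) := by
  rw [ZXZop_eq, gen4_flip_mulVec]

theorem eq_zero_iff_forall_copies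
    (v : (Fin 2 → (Fin n → Fin 2)) × (Fin 2 → (Fin n → Fin 2)) → ℂ) :
    v = 0 ↔ ∀ q, v (copies q) = 0 :=
  ⟨fun h q => by rw [h, Pi.zero_apply], fun h => funext fun p => by
    obtain ⟨q, rfl⟩ := copies_surjective p
    exact h q⟩

end SiteMajor

section ProductStates

/-- Copies `k` and `l` of a single-site vector are paired with sign `η`: both `X` and `Z` act in
the same way on the two copies, up to the sign `η`. -/
structure PairedCopies (ψ : (Fin 4 → Fin 2) → ℂ) (k l : Fin 4) (η : ℂ) : Prop where
  flip : ∀ b, ψ (bitFlip k b) = η * ψ (bitFlip l b)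
  zSign : ∀ b, ψ b ≠ 0 → zSign (b k) = η * zSign (b l)

theorem forall_bits_iff {p : (Fin 4 → Fin 2) → Prop} :
    (∀ b, p b) ↔ ∀ b₀ b₁ b₂ b₃ : Fin 2, p ![b₀, b₁, b₂, b₃] := by
  refine ⟨fun h _ _ _ _ => h _, fun h b => ?_⟩
  have hb : b = ![b 0, b 1, b 2, b 3] := by
    funext k; fin_cases k <;> rfl
  rw [hb]
  exact h _ _ _ _

theorem bitFlip_zero (b₀ b₁ b₂ b₃ : Fin 2) :
    bitFlip 0 ![b₀, b₁, b₂, b₃] = ![b₀ + 1, b₁, b₂, b₃] := by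
  funext k; fin_cases k <;> rfl

theorem bitFlip_one (b₀ b₁ b₂ b₃ : Fin 2) :
    bitFlip 1 ![b₀, b₁, b₂, b₃] = ![b₀, b₁ + 1, b₂, b₃] := by
  funext k; fin_cases k <;> rfl

theorem bitFlip_two (b₀ b₁ b₂ b₃ : Fin 2) :
    bitFlip 2 ![b₀, b₁, b₂, b₃] = ![b₀, b₁, b₂ + 1, b₃] := by
  funext k; fin_cases k <;> rfl

theorem bitFlip_three (b₀ b₁ b₂ b₃ : Fin 2) :
    bitFlip 3 ![b₀, b₁, b₂, b₃] = ![b₀, b₁, b₂, b₃ + 1] := by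
  funext k; fin_cases k <;> rfl

theorem pairedCopies_psi0 : PairedCopies psi0 0 2 1 ∧ PairedCopies psi0 1 3 1 := by
  refine ⟨⟨?_, ?_⟩, ⟨?_, ?_⟩⟩ <;> rw [forall_bits_iff] <;> intro b₀ b₁ b₂ b₃ <;>
    fin_cases b₀ <;> fin_cases b₁ <;> fin_cases b₂ <;> fin_cases b₃ <;>
    simp [bitFlip_zero, bitFlip_one, bitFlip_two, bitFlip_three, psi0, zSign]

theorem pairedCopies_psi1 : PairedCopies psi1 0 3 1 ∧ PairedCopies psi1 1 2 1 := by
  refine ⟨⟨?_, ?_⟩, ⟨?_, ?_⟩⟩ <;> rw [forall_bits_iff] <;> intro b₀ b₁ b₂ b₃ <;>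
    fin_cases b₀ <;> fin_cases b₁ <;> fin_cases b₂ <;> fin_cases b₃ <;>
    simp [bitFlip_zero, bitFlip_one, bitFlip_two, bitFlip_three, psi1, zSign]

theorem pairedCopies_psiphi : PairedCopies psiphi 0 1 (-1) ∧ PairedCopies psiphi 2 3 (-1) := by
  refine ⟨⟨?_, ?_⟩, ⟨?_, ?_⟩⟩ <;> rw [forall_bits_iff] <;> intro b₀ b₁ b₂ b₃ <;>
    fin_cases b₀ <;> fin_cases b₁ <;> fin_cases b₂ <;> fin_cases b₃ <;>
    simp [bitFlip_zero, bitFlip_one, bitFlip_two, bitFlip_three, psiphi, psi0, psi1, zSign]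

variable {n : ℕ} {ψ : (Fin 4 → Fin 2) → ℂ} {k l : Fin 4} {η : ℂ}

theorem gvec_flipAt (ψ : (Fin 4 → Fin 2) → ℂ) (q : Fin n → Fin 4 → Fin 2) (i : Fin n)
    (k : Fin 4) :
    gvec n ψ (copies (flipAt q i k)) =
      ψ (bitFlip k (q i)) * ∏ j ∈ Finset.univ.erase i, ψ (q j) := by
  rw [gvec_copies, ← Finset.mul_prod_erase _ _ (Finset.mem_univ i), flipAt,
    Function.update_self]
  congr 1
  refine Finset.prod_congr rfl fun j hj => ?_
  rw [Function.update_of_ne (Finset.ne_of_mem_erase hj)]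

theorem PairedCopies.gvec_flipAt (h : PairedCopies ψ k l η) (q : Fin n → Fin 4 → Fin 2)
    (i : Fin n) : gvec n ψ (copies (flipAt q i k)) = η * gvec n ψ (copies (flipAt q i l)) := by
  rw [_root_.gvec_flipAt, _root_.gvec_flipAt, h.flip, mul_assoc]

theorem PairedCopies.zSign_mul_gvec (h : PairedCopies ψ k l η) (q : Fin n → Fin 4 → Fin 2)
    (i : Fin n) : _root_.zSign (q i k) * gvec n ψ (copies q) =
      η * (_root_.zSign (q i l) * gvec n ψ (copies q)) := by
  rw [gvec_copies]
  by_cases h0 : ψ (q i) = 0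
  · rw [Finset.prod_eq_zero (Finset.mem_univ i) h0, mul_zero, mul_zero, mul_zero]
  · rw [h.zSign _ h0, mul_assoc]

theorem PairedCopies.zxz_gvec (h : PairedCopies ψ k l η) (hη : η * η = 1)
    (q : Fin n → Fin 4 → Fin 2) (i : Fin n)
    (hi : η = 1 ∨ (0 < (i : ℕ) ∧ (i : ℕ) + 1 < n)) :
    zxzSign i (fun j => q j k) * gvec n ψ (copies (flipAt q i k)) =
      η * (zxzSign i (fun j => q j l) * gvec n ψ (copies (flipAt q i l))) := by
  rw [_root_.gvec_flipAt, _root_.gvec_flipAt, h.flip]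
  by_cases h0 : ∏ j ∈ Finset.univ.erase i, ψ (q j) = 0
  · simp [h0]
  · have hz : ∀ j, j ≠ i → _root_.zSign (q j k) = η * _root_.zSign (q j l) := fun j hj =>
      h.zSign _ (Finset.prod_ne_zero_iff.1 h0 j (Finset.mem_erase.2 ⟨hj, Finset.mem_univ j⟩))
    have hs : zxzSign i (fun j => q j k) = zxzSign i (fun j => q j l) := by
      unfold zxzSign
      rcases hi with rfl | ⟨h1, h2⟩
      · congr 1
        · refine dite_congr rfl (fun h => ?_) fun _ => rfl
          rw [hz _ (by simp only [ne_eq, Fin.ext_iff]; omega), one_mul]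
        · refine dite_congr rfl (fun h => ?_) fun _ => rfl
          rw [hz _ (by simp only [ne_eq, Fin.ext_iff]; omega), one_mul]
      · rw [dif_pos h1, dif_pos h2, dif_pos h1, dif_pos h2,
          hz _ (by simp only [ne_eq, Fin.ext_iff]; omega),
          hz _ (by simp only [ne_eq, Fin.ext_iff]; omega), mul_mul_mul_comm, hη, one_mul]
    rw [hs]
    ring

theorem gvec_mem_ker_HhamOn {S : Finset (Fin n)} {k₁ l₁ k₂ l₂ : Fin 4} (hη : η * η = 1)
    (h₁ : PairedCopies ψ k₁ l₁ η) (h₂ : PairedCopies ψ k₂ l₂ η)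
    (hsum : ∀ t : Fin 4 → ℂ, t k₁ = η * t l₁ → t k₂ = η * t l₂ → ∑ k, copySign k * t k = 0)
    (hS : ∀ i ∈ S, η = 1 ∨ (0 < (i : ℕ) ∧ (i : ℕ) + 1 < n)) :
    gvec n ψ ∈ LinearMap.ker (Matrix.toLin' (HhamOn S)) := by
  rw [mem_ker_HhamOn_iff]
  refine ⟨fun i => ?_, fun i => ?_, fun i hi => ?_⟩ <;>
    refine (eq_zero_iff_forall_copies _).2 fun q => ?_
  · rw [gen4_Xop_mulVec]
    exact hsum _ (h₁.gvec_flipAt q i) (h₂.gvec_flipAt q i)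
  · rw [gen4_Zop_mulVec, Finset.sum_mul]
    simp only [mul_assoc]
    exact hsum _ (h₁.zSign_mul_gvec q i) (h₂.zSign_mul_gvec q i)
  · rw [gen4_ZXZop_mulVec]
    exact hsum _ (h₁.zxz_gvec hη q i (hS i hi)) (h₂.zxz_gvec hη q i (hS i hi))

theorem gvec_psi0_mem_ker (S : Finset (Fin n)) :
    gvec n psi0 ∈ LinearMap.ker (Matrix.toLin' (HhamOn S)) := by
  refine gvec_mem_ker_HhamOn (one_mul 1) pairedCopies_psi0.1 pairedCopies_psi0.2 ?_
    fun _ _ => Or.inl rfl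
  intro t h h'
  simp [Fin.sum_univ_four, copySign, h, h']

theorem gvec_psi1_mem_ker (S : Finset (Fin n)) :
    gvec n psi1 ∈ LinearMap.ker (Matrix.toLin' (HhamOn S)) := by
  refine gvec_mem_ker_HhamOn (one_mul 1) pairedCopies_psi1.1 pairedCopies_psi1.2 ?_
    fun _ _ => Or.inl rfl
  intro t h h'
  simp [Fin.sum_univ_four, copySign, h, h']

theorem gvec_psiphi_mem_ker {S : Finset (Fin n)}
    (hS : ∀ i ∈ S, 0 < (i : ℕ) ∧ (i : ℕ) + 1 < n) :
    gvec n psiphi ∈ LinearMap.ker (Matrix.toLin' (HhamOn S)) := by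
  refine gvec_mem_ker_HhamOn (by norm_num) pairedCopies_psiphi.1 pairedCopies_psiphi.2 ?_
    fun i hi => Or.inr (hS i hi)
  intro t h h'
  simp [Fin.sum_univ_four, copySign, h, h']

end ProductStates

section StringPropagation

/-- A property of bit strings which is unaffected by changing a window of three consecutive bits,
as long as the window is not constant, takes the same value on all strings that are not constant
on an initial segment and agree beyond it. -/
theorem iff_of_window_invariant {n : ℕ} {p : (ℕ → Bool) → Prop}
    (hp : ∀ i, i + 2 < n → ∀ s t : ℕ → Bool,
      (∀ j, j ≠ i → j ≠ i + 1 → j ≠ i + 2 → s j = t j) →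
      ¬(s i = s (i + 1) ∧ s (i + 1) = s (i + 2)) →
      ¬(t i = t (i + 1) ∧ t (i + 1) = t (i + 2)) → (p s ↔ p t))
    {k : ℕ} (hk : 2 ≤ k) (hkn : k < n) : ∀ s t : ℕ → Bool, (∀ j, k < j → s j = t j) →
      (∃ i < k, s i ≠ s (i + 1)) → (∃ i < k, t i ≠ t (i + 1)) → (p s ↔ p t) := by
  induction k, hk using Nat.le_induction with
  | base =>
    intro s t hst ⟨i, hi, hs⟩ ⟨i', hi', ht⟩
    refine hp 0 hkn s t (fun j _ _ _ => hst j (by omega)) ?_ ?_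
    · rintro ⟨h1, h2⟩
      interval_cases i
      exacts [hs h1, hs h2]
    · rintro ⟨h1, h2⟩
      interval_cases i'
      exacts [ht h1, ht h2]
  | succ k hk ih =>
    have ih := ih (by omega)
    have ex_of_ne : ∀ {s : ℕ → Bool}, s (k - 1) ≠ s k → ∃ i < k, s i ≠ s (i + 1) := fun {s} h =>
      ⟨k - 1, by omega, by rwa [Nat.sub_add_cancel (by omega : 1 ≤ k)]⟩
    have hwin := hp (k - 1) (by omega)
    rw [show k - 1 + 1 = k by omega, show k - 1 + 2 = k + 1 by omega] at hwin
    -- every string is equivalent to the one with a single `true` at position `k`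
    have normal : ∀ s : ℕ → Bool, (∃ i < k + 1, s i ≠ s (i + 1)) →
        (p s ↔ p fun j => if j ≤ k + 1 then decide (j = k) else s j) := by
      have main : ∀ s : ℕ → Bool, (∃ i < k, s i ≠ s (i + 1)) →
          (p s ↔ p fun j => if j ≤ k + 1 then decide (j = k) else s j) := by
        intro s hs
        have h1 : p s ↔ p fun j => if j ≤ k then decide (j = k - 1) else s j := by
          refine ih _ _ (fun j hj => (if_neg (by omega)).symm) hs (ex_of_ne ?_)
          simp [show k ≠ k - 1 by omega]
        refine h1.trans (hwin _ _ ?_ ?_ ?_)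
        · intro j h1 h2 h3
          rcases lt_or_ge j (k + 1) with h | h
          · simp [show j ≤ k by omega, show j ≤ k + 1 by omega, h1, h2]
          · simp [show ¬ j ≤ k by omega, show ¬ j ≤ k + 1 by omega]
        · simp [show k ≠ k - 1 by omega]
        · simp [show k - 1 ≠ k by omega, show k - 1 ≤ k + 1 by omega]
      intro s hs
      by_cases hsk : ∃ i < k, s i ≠ s (i + 1)
      · exact main s hsk
      · push Not at hsk
        obtain ⟨i, hi, hne⟩ := hs
        obtain rfl : i = k := by
          by_contra h
          exact hne (hsk i (by omega))
        have h1 : p s ↔ p fun j => if j = i - 1 then true else if j = i then false else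
            if j = i + 1 then false else s j := by
          refine hwin _ _ ?_ ?_ ?_
          · intro j h1 h2 h3
            simp [h1, h2, h3]
          · exact fun h => hne h.2
          · simp [show i ≠ i - 1 by omega]
        refine h1.trans ((main _ (ex_of_ne ?_)).trans (iff_of_eq (congrArg p ?_)))
        · simp [show i ≠ i - 1 by omega]
        · funext j
          rcases le_or_gt j (i + 1) with h | h
          · simp [h]
          · simp [show ¬ j ≤ i + 1 by omega, show j ≠ i - 1 by omega, show j ≠ i by omega,
              show j ≠ i + 1 by omega]
    intro s t hst hs ht
    rw [normal s hs, normal t ht]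
    refine iff_of_eq (congrArg p (funext fun j => ?_))
    split_ifs with h
    · rfl
    · exact hst j (by omega)

end StringPropagation

section GroundSpace

/-- The labels `0101` and `0110`, on which the values of `ψ₀` and `ψ₁` are supported separately. -/
def siteLabel (x : Bool) : Fin 4 → Fin 2 := if x then ![0, 1, 1, 0] else ![0, 1, 0, 1]

/-- A single-site vector annihilated by the `X` and `Z` generators is a combination
of `ψ₀` and `ψ₁`. -/
theorem single_site_expansion {f : (Fin 4 → Fin 2) → ℂ}
    (hX : ∀ b, ∑ k, copySign k * f (bitFlip k b) = 0)
    (hZ : ∀ b, (∑ k, copySign k * zSign (b k)) * f b = 0) :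
    ∀ b, f b = 2 * psi0 b * f (siteLabel false) + 2 * psi1 b * f (siteLabel true) := by
  have h1 := hX ![1, 0, 0, 0]
  have h2 := hX ![0, 1, 0, 0]
  have h3 := hX ![0, 0, 1, 0]
  have h4 := hX ![0, 0, 0, 1]
  have h5 := hX ![1, 1, 1, 0]
  have h0 := hZ ![1, 1, 0, 0]
  have h0' := hZ ![0, 0, 1, 1]
  simp [Fin.sum_univ_four, copySign, bitFlip_zero, bitFlip_one, bitFlip_two, bitFlip_three,
    zSign] at h1 h2 h3 h4 h5 h0 h0'
  norm_num at h0 h0'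
  rw [forall_bits_iff]
  intro b₀ b₁ b₂ b₃
  have h := hZ ![b₀, b₁, b₂, b₃]
  simp only [Fin.sum_univ_four] at h
  fin_cases b₀ <;> fin_cases b₁ <;> fin_cases b₂ <;> fin_cases b₃ <;>
    simp [copySign, zSign, psi0, psi1, siteLabel] at h ⊢ <;> norm_num at h ⊢ <;> grind

theorem single_site_values {f : (Fin 4 → Fin 2) → ℂ}
    (hf : ∀ b, f b = 2 * psi0 b * f (siteLabel false) + 2 * psi1 b * f (siteLabel true)) :
    f ![0, 0, 0, 0] = f (siteLabel false) + f (siteLabel true) ∧ f ![1, 1, 0, 0] = 0 ∧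
      f ![1, 0, 1, 0] = f (siteLabel false) ∧ f ![1, 0, 0, 1] = f (siteLabel true) := by
  refine ⟨?_, ?_, ?_, ?_⟩ <;> rw [hf] <;> simp [psi0, psi1]

theorem window_vanishing {F : (Fin 4 → Fin 2) → (Fin 4 → Fin 2) → (Fin 4 → Fin 2) → ℂ}
    (h₁ : ∀ b c a, F a b c =
      2 * psi0 a * F (siteLabel false) b c + 2 * psi1 a * F (siteLabel true) b c)
    (h₂ : ∀ a c b, F a b c =
      2 * psi0 b * F a (siteLabel false) c + 2 * psi1 b * F a (siteLabel true) c)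
    (h₃ : ∀ a b c, F a b c =
      2 * psi0 c * F a b (siteLabel false) + 2 * psi1 c * F a b (siteLabel true))
    (hF : ∀ a b c, ∑ k, copySign k * (zSign (a k) * zSign (c k) * F a (bitFlip k b) c) = 0)
    {x y z x' y' z' : Bool} (hne : ¬(x = y ∧ y = z)) (hne' : ¬(x' = y' ∧ y' = z'))
    (h0 : F (siteLabel x) (siteLabel y) (siteLabel z) = 0) :
    F (siteLabel x') (siteLabel y') (siteLabel z') = 0 := by
  have e₁ := fun b c => (single_site_values (f := fun a => F a b c) (h₁ b c)).1
  have e₂ := fun a c => single_site_values (f := fun b => F a b c) (h₂ a c)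
  have e₃ := fun a b => (single_site_values (f := fun c => F a b c) (h₃ a b)).1
  have key := fun a c => hF a ![1, 0, 0, 0] c
  simp [Fin.sum_univ_four, copySign, bitFlip_zero, bitFlip_one, bitFlip_two, bitFlip_three,
    e₂] at key
  have k1 := key (siteLabel false) (siteLabel true)
  have k2 := key (siteLabel true) (siteLabel false)
  have k3 := key ![0, 0, 0, 0] (siteLabel false)
  have k4 := key ![0, 0, 0, 0] (siteLabel true)
  have k5 := key (siteLabel false) ![0, 0, 0, 0]
  have k6 := key (siteLabel true) ![0, 0, 0, 0]
  simp only [e₁, e₃] at k3 k4 k5 k6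
  have s0 : ∀ y, siteLabel y 0 = 0 := by decide
  have s2 : ∀ y, siteLabel y 2 = if y then 1 else 0 := by decide
  have s3 : ∀ y, siteLabel y 3 = if y then 0 else 1 := by decide
  simp [zSign, s0, s2, s3] at k1 k2 k3 k4 k5 k6
  cases x <;> cases y <;> cases z <;> simp at hne <;>
    cases x' <;> cases y' <;> cases z' <;> simp at hne' <;> grind

variable {n : ℕ} {S : Finset (Fin n)}
  {v : (Fin 2 → (Fin n → Fin 2)) × (Fin 2 → (Fin n → Fin 2)) → ℂ}

/-- The basis label with the site labels prescribed by a bit string. -/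
def stringLabel (n : ℕ) (s : ℕ → Bool) : (Fin 2 → (Fin n → Fin 2)) × (Fin 2 → (Fin n → Fin 2)) :=
  copies fun i => siteLabel (s i)

theorem site_expansion (hv : v ∈ LinearMap.ker (Matrix.toLin' (HhamOn S)))
    (q : Fin n → Fin 4 → Fin 2) (i : Fin n) (b : Fin 4 → Fin 2) :
    v (copies (Function.update q i b)) =
      2 * psi0 b * v (copies (Function.update q i (siteLabel false))) +
        2 * psi1 b * v (copies (Function.update q i (siteLabel true))) := by
  obtain ⟨hX, hZ, -⟩ := (mem_ker_HhamOn_iff S v).1 hv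
  refine single_site_expansion (f := fun b => v (copies (Function.update q i b)))
    (fun b => ?_) (fun b => ?_) b
  · have h := (eq_zero_iff_forall_copies _).1 (hX i) (Function.update q i b)
    simpa only [gen4_Xop_mulVec, flipAt, Function.update_self, Function.update_idem] using h
  · have h := (eq_zero_iff_forall_copies _).1 (hZ i) (Function.update q i b)
    simpa only [gen4_Zop_mulVec, Function.update_self] using h

theorem eq_zero_of_stringLabel_eq_zero (hv : v ∈ LinearMap.ker (Matrix.toLin' (HhamOn S)))
    (h0 : ∀ s, v (stringLabel n s) = 0) : v = 0 := by
  have key : ∀ (T : Finset (Fin n)) (q : Fin n → Fin 4 → Fin 2),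
      (∀ j ∉ T, ∃ x, q j = siteLabel x) → v (copies q) = 0 := by
    intro T
    induction T using Finset.induction_on with
    | empty =>
      intro q hq
      choose s hs using fun j => hq j (Finset.notMem_empty j)
      have h := h0 fun j => if h : j < n then s ⟨j, h⟩ else false
      simpa [stringLabel, ← hs] using h
    | insert a T ha ih =>
      intro q hq
      have hlab : ∀ x, v (copies (Function.update q a (siteLabel x))) = 0 := fun x => by
        refine ih _ fun j hj => ?_
        by_cases hja : j = a
        · exact ⟨x, by rw [hja, Function.update_self]⟩
        · rw [Function.update_of_ne hja]
          exact hq j (by simp [hja, hj])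
      have h := site_expansion hv q a (q a)
      rwa [Function.update_eq_self, hlab, hlab, mul_zero, mul_zero, add_zero] at h
  exact (eq_zero_iff_forall_copies v).2 fun q => key Finset.univ q (by simp)

theorem stringLabel_window (hv : v ∈ LinearMap.ker (Matrix.toLin' (HhamOn S)))
    (hS : ∀ i : Fin n, 0 < (i : ℕ) → (i : ℕ) + 1 < n → i ∈ S) (i : ℕ) (hi : i + 2 < n)
    {s t : ℕ → Bool} (hst : ∀ j, j ≠ i → j ≠ i + 1 → j ≠ i + 2 → s j = t j)
    (hs : ¬(s i = s (i + 1) ∧ s (i + 1) = s (i + 2)))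
    (ht : ¬(t i = t (i + 1) ∧ t (i + 1) = t (i + 2))) (h0 : v (stringLabel n s) = 0) :
    v (stringLabel n t) = 0 := by
  obtain ⟨-, -, hZXZ⟩ := (mem_ker_HhamOn_iff S v).1 hv
  let i₀ : Fin n := ⟨i, by omega⟩
  let i₁ : Fin n := ⟨i + 1, by omega⟩
  let i₂ : Fin n := ⟨i + 2, hi⟩
  have h01 : i₀ ≠ i₁ := by simp [i₀, i₁]
  have h02 : i₀ ≠ i₂ := by simp [i₀, i₂]
  have h12 : i₁ ≠ i₂ := by simp [i₁, i₂]
  let Q : (Fin 4 → Fin 2) → (Fin 4 → Fin 2) → (Fin 4 → Fin 2) → Fin n → Fin 4 → Fin 2 :=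
    fun a b c => Function.update (Function.update (Function.update
      (fun j : Fin n => siteLabel (s j)) i₀ a) i₁ b) i₂ c
  have hQ₀ : ∀ a b c, Q a b c = Function.update (Function.update (Function.update
      (fun j : Fin n => siteLabel (s j)) i₁ b) i₂ c) i₀ a := fun a b c => by
    simp only [Q]
    rw [Function.update_comm h01, Function.update_comm h02]
  have hQ₁ : ∀ a b c, Q a b c = Function.update (Function.update (Function.update
      (fun j : Fin n => siteLabel (s j)) i₀ a) i₂ c) i₁ b := fun a b c => by
    simp only [Q]
    rw [Function.update_comm h12]
  have hlabel : ∀ r : ℕ → Bool, (∀ j, j ≠ i → j ≠ i + 1 → j ≠ i + 2 → s j = r j) →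
      copies (Q (siteLabel (r i)) (siteLabel (r (i + 1))) (siteLabel (r (i + 2)))) =
        stringLabel n r := by
    intro r hr
    refine congrArg copies (funext fun j => ?_)
    simp only [Q]
    by_cases hj2 : j = i₂
    · subst hj2; rw [Function.update_self]
    rw [Function.update_of_ne hj2]
    by_cases hj1 : j = i₁
    · subst hj1; rw [Function.update_self]
    rw [Function.update_of_ne hj1]
    by_cases hj0 : j = i₀
    · subst hj0; rw [Function.update_self]
    rw [Function.update_of_ne hj0, hr j (fun h => hj0 (Fin.ext h)) (fun h => hj1 (Fin.ext h))
      fun h => hj2 (Fin.ext h)]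
  rw [← hlabel s fun _ _ _ _ => rfl] at h0
  rw [← hlabel t hst]
  refine window_vanishing (F := fun a b c => v (copies (Q a b c))) ?_ ?_ ?_ ?_ hs ht h0
  · intro b c a
    simp only [hQ₀]
    exact site_expansion hv _ _ _
  · intro a c b
    simp only [hQ₁]
    exact site_expansion hv _ _ _
  · intro a b c
    exact site_expansion hv _ _ _
  · intro a b c
    have h := (eq_zero_iff_forall_copies _).1
      (hZXZ i₁ (hS i₁ (Nat.succ_pos i) hi)) (Q a b c)
    rw [gen4_ZXZop_mulVec] at h
    rw [← h]
    refine Finset.sum_congr rfl fun k _ => ?_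
    have hσ : zxzSign i₁ (fun j => Q a b c j k) = zSign (a k) * zSign (c k) := by
      have ha : Q a b c i₀ = a := by rw [hQ₀, Function.update_self]
      have hc : Q a b c i₂ = c := Function.update_self ..
      rw [zxzSign, dif_pos (Nat.succ_pos i), dif_pos (show (i₁ : ℕ) + 1 < n from hi)]
      change zSign (Q a b c i₀ k) * zSign (Q a b c i₂ k) = _
      rw [ha, hc]
    have hflip : flipAt (Q a b c) i₁ k = Q a (bitFlip k b) c := by
      rw [flipAt, hQ₁, hQ₁, Function.update_self, Function.update_idem]
    rw [hσ, hflip]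

theorem stringLabel_edge (hn : 2 ≤ n) (hv : v ∈ LinearMap.ker (Matrix.toLin' (HhamOn S)))
    (hS : (⟨0, by omega⟩ : Fin n) ∈ S) : v (stringLabel n fun j => decide (j = 0)) = 0 := by
  obtain ⟨-, -, hZXZ⟩ := (mem_ker_HhamOn_iff S v).1 hv
  let i₀ : Fin n := ⟨0, by omega⟩
  let q : Fin n → Fin 4 → Fin 2 := fun _ => siteLabel false
  have hval := single_site_values (f := fun b => v (copies (Function.update q i₀ b)))
    (site_expansion hv q i₀)
  have h := (eq_zero_iff_forall_copies _).1 (hZXZ i₀ hS) (Function.update q i₀ ![1, 0, 0, 0])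
  have hσ : ∀ k, zxzSign i₀ (fun j => Function.update q i₀ ![1, 0, 0, 0] j k) =
      zSign (siteLabel false k) := fun k => by
    rw [zxzSign, dif_neg (lt_irrefl 0), dif_pos (show (i₀ : ℕ) + 1 < n from hn), one_mul,
      Function.update_of_ne]
    simp [i₀]
  simp only [gen4_ZXZop_mulVec, hσ, flipAt, Function.update_self, Function.update_idem,
    Fin.sum_univ_four, bitFlip_zero, bitFlip_one, bitFlip_two, bitFlip_three] at h
  simp [hval, copySign, zSign, siteLabel] at h
  have hlab : stringLabel n (fun j => decide (j = 0)) =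
      copies (Function.update q i₀ (siteLabel true)) := by
    refine congrArg copies (funext fun j => ?_)
    by_cases hj : j = i₀
    · subst hj; simp [i₀]
    · rw [Function.update_of_ne hj]
      have : (j : ℕ) ≠ 0 := fun h => hj (Fin.ext h)
      simp [this, q]
  rw [hlab, siteLabel]
  simpa using h

theorem eq_zero_of_mem_ker (hn : 3 ≤ n) (hv : v ∈ LinearMap.ker (Matrix.toLin' (HhamOn S)))
    (hS : ∀ i : Fin n, 0 < (i : ℕ) → (i : ℕ) + 1 < n → i ∈ S)
    (hfalse : v (stringLabel n fun _ => false) = 0) (htrue : v (stringLabel n fun _ => true) = 0)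
    (hmixed : v (stringLabel n fun j => decide (j = 0)) = 0) : v = 0 := by
  have hcut : ∀ s : ℕ → Bool, ∃ t : ℕ → Bool, stringLabel n s = stringLabel n t ∧
      ∀ j, n - 1 < j → t j = false := fun s =>
    ⟨fun j => if j < n then s j else false, congrArg copies (funext fun j => by simp),
      fun j hj => if_neg (by omega)⟩
  refine eq_zero_of_stringLabel_eq_zero hv fun s => ?_
  obtain ⟨t, hst, ht⟩ := hcut s
  rw [hst]
  by_cases hc : ∃ i < n - 1, t i ≠ t (i + 1)
  · refine (iff_of_window_invariant (p := fun s => v (stringLabel n s) = 0) (n := n)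
      (fun i hi s t h hs ht => ⟨stringLabel_window hv hS i hi h hs ht,
        stringLabel_window hv hS i hi (fun j h0 h1 h2 => (h j h0 h1 h2).symm) ht hs⟩)
      (k := n - 1) (by omega) (by omega) t (fun j => decide (j = 0)) ?_ hc ?_).2 hmixed
    · intro j hj
      rw [ht j hj, eq_comm, decide_eq_false_iff_not]
      omega
    · exact ⟨0, by omega, by simp⟩
  · push Not at hc
    have hconst : ∀ j, j < n → t j = t 0 := by
      intro j
      induction j with
      | zero => exact fun _ => rfl
      | succ j ih => exact fun hj => (hc j (by omega)).symm.trans (ih (by omega))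
    have hlab : stringLabel n t = stringLabel n fun _ => t 0 :=
      congrArg copies (funext fun j => by rw [hconst j j.isLt])
    rw [hlab]
    cases t 0
    exacts [hfalse, htrue]

theorem gvec_stringLabel (ψ : (Fin 4 → Fin 2) → ℂ) (s : ℕ → Bool) :
    gvec n ψ (stringLabel n s) = ∏ i : Fin n, ψ (siteLabel (s i)) :=
  gvec_copies _ _

theorem psi0_siteLabel (x : Bool) : psi0 (siteLabel x) = if x then 0 else 1 / 2 := by
  cases x <;> simp [psi0, siteLabel]

theorem psi1_siteLabel (x : Bool) : psi1 (siteLabel x) = if x then 1 / 2 else 0 := by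
  cases x <;> simp [psi1, siteLabel]

theorem gvec_psi0_stringLabel_eq_zero {s : ℕ → Bool} {i : ℕ} (hi : i < n) (hs : s i = true) :
    gvec n psi0 (stringLabel n s) = 0 := by
  rw [gvec_stringLabel]
  exact Finset.prod_eq_zero (Finset.mem_univ ⟨i, hi⟩) (by simp [psi0_siteLabel, hs])

theorem gvec_psi1_stringLabel_eq_zero {s : ℕ → Bool} {i : ℕ} (hi : i < n) (hs : s i = false) :
    gvec n psi1 (stringLabel n s) = 0 := by
  rw [gvec_stringLabel]
  exact Finset.prod_eq_zero (Finset.mem_univ ⟨i, hi⟩) (by simp [psi1_siteLabel, hs])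

theorem gvec_psi0_stringLabel_ne_zero : gvec n psi0 (stringLabel n fun _ => false) ≠ 0 := by
  simp [gvec_stringLabel, psi0_siteLabel]

theorem gvec_psi1_stringLabel_ne_zero : gvec n psi1 (stringLabel n fun _ => true) ≠ 0 := by
  simp [gvec_stringLabel, psi1_siteLabel]

theorem gvec_psiphi_stringLabel_ne_zero (s : ℕ → Bool) :
    gvec n psiphi (stringLabel n s) ≠ 0 := by
  rw [gvec_stringLabel]
  refine Finset.prod_ne_zero_iff.2 fun i _ => ?_
  rw [psiphi, Pi.sub_apply, psi0_siteLabel, psi1_siteLabel]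
  cases s i <;> simp

theorem ker_HhamOn_eq_span_pair (hn : 3 ≤ n) (hpos : 0 < n)
    (hS : ∀ i : Fin n, 0 < (i : ℕ) → (i : ℕ) + 1 < n → i ∈ S)
    (hS0 : (⟨0, hpos⟩ : Fin n) ∈ S) :
    LinearMap.ker (Matrix.toLin' (HhamOn S)) = Submodule.span ℂ {gvec n psi0, gvec n psi1} := by
  refine le_antisymm (fun v hv => ?_) (Submodule.span_le.2 ?_)
  · rw [Submodule.mem_span_pair]
    have h0 := gvec_psi0_stringLabel_ne_zero (n := n)
    have h1 := gvec_psi1_stringLabel_ne_zero (n := n)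
    refine ⟨v (stringLabel n fun _ => false) / gvec n psi0 (stringLabel n fun _ => false),
      v (stringLabel n fun _ => true) / gvec n psi1 (stringLabel n fun _ => true), ?_⟩
    rw [eq_comm, ← sub_eq_zero]
    have hw := Submodule.sub_mem _ hv (Submodule.add_mem _
      (Submodule.smul_mem _ (v (stringLabel n fun _ => false) /
        gvec n psi0 (stringLabel n fun _ => false)) (gvec_psi0_mem_ker S))
      (Submodule.smul_mem _ (v (stringLabel n fun _ => true) /
        gvec n psi1 (stringLabel n fun _ => true)) (gvec_psi1_mem_ker S)))
    refine eq_zero_of_mem_ker hn hw hS ?_ ?_ (stringLabel_edge (by omega) hw hS0)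
    · simp [gvec_psi1_stringLabel_eq_zero (s := fun _ => false) (by omega : 0 < n) rfl, h0]
    · simp [gvec_psi0_stringLabel_eq_zero (s := fun _ => true) (by omega : 0 < n) rfl, h1]
  · rintro _ (rfl | rfl)
    exacts [gvec_psi0_mem_ker S, gvec_psi1_mem_ker S]

theorem ker_HhamOn_eq_span_triple (hn : 3 ≤ n)
    (hS : ∀ i : Fin n, i ∈ S ↔ 0 < (i : ℕ) ∧ (i : ℕ) + 1 < n) :
    LinearMap.ker (Matrix.toLin' (HhamOn S)) =
      Submodule.span ℂ {gvec n psi0, gvec n psi1, gvec n psiphi} := by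
  have hmem := gvec_psiphi_mem_ker fun i hi => (hS i).1 hi
  refine le_antisymm (fun v hv => ?_) (Submodule.span_le.2 ?_)
  · rw [Submodule.mem_span_triple]
    have h0 := gvec_psi0_stringLabel_ne_zero (n := n)
    have h1 := gvec_psi1_stringLabel_ne_zero (n := n)
    have hφ := gvec_psiphi_stringLabel_ne_zero (n := n) fun j => decide (j = 0)
    obtain ⟨c, hc⟩ : ∃ c, c = v (stringLabel n fun j => decide (j = 0)) /
      gvec n psiphi (stringLabel n fun j => decide (j = 0)) := ⟨_, rfl⟩
    obtain ⟨a, ha⟩ : ∃ a, a = (v (stringLabel n fun _ => false) -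
      c * gvec n psiphi (stringLabel n fun _ => false)) /
        gvec n psi0 (stringLabel n fun _ => false) := ⟨_, rfl⟩
    obtain ⟨b, hb⟩ : ∃ b, b = (v (stringLabel n fun _ => true) -
      c * gvec n psiphi (stringLabel n fun _ => true)) /
        gvec n psi1 (stringLabel n fun _ => true) := ⟨_, rfl⟩
    refine ⟨a, b, c, ?_⟩
    rw [eq_comm, ← sub_eq_zero]
    have hw := Submodule.sub_mem _ hv (Submodule.add_mem _ (Submodule.add_mem _
      (Submodule.smul_mem _ a (gvec_psi0_mem_ker S))
      (Submodule.smul_mem _ b (gvec_psi1_mem_ker S))) (Submodule.smul_mem _ c hmem))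
    simp only [add_assoc] at hw ⊢
    refine eq_zero_of_mem_ker hn hw (fun i h h' => (hS i).2 ⟨h, h'⟩) ?_ ?_ ?_
    · simp [gvec_psi1_stringLabel_eq_zero (s := fun _ => false) (by omega : 0 < n) rfl, ha, h0]
    · simp [gvec_psi0_stringLabel_eq_zero (s := fun _ => true) (by omega : 0 < n) rfl, hb, h1]
    · simp [gvec_psi0_stringLabel_eq_zero (s := fun j => decide (j = 0))
          (by omega : 0 < n) rfl,
        gvec_psi1_stringLabel_eq_zero (s := fun j => decide (j = 0))
          (by omega : 1 < n) rfl, hc, hφ]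
  · rintro _ (rfl | rfl | rfl)
    exacts [gvec_psi0_mem_ker S, gvec_psi1_mem_ker S, hmem]

theorem linearIndependent_gvec (hn : 2 ≤ n) :
    LinearIndependent ℂ ![gvec n psi0, gvec n psi1, gvec n psiphi] := by
  rw [Fintype.linearIndependent_iff]
  intro g hg
  simp only [Fin.sum_univ_three, Matrix.cons_val_zero, Matrix.cons_val_one,
    Matrix.cons_val_two, Matrix.tail_cons, Matrix.head_cons] at hg
  have hmixed := congrFun hg (stringLabel n fun j => decide (j = 0))
  have hfalse := congrFun hg (stringLabel n fun _ => false)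
  have htrue := congrFun hg (stringLabel n fun _ => true)
  have h2 : g 2 = 0 := by
    simpa [gvec_psi0_stringLabel_eq_zero (s := fun j => decide (j = 0))
        (by omega : 0 < n) rfl,
      gvec_psi1_stringLabel_eq_zero (s := fun j => decide (j = 0))
        (by omega : 1 < n) rfl, gvec_psiphi_stringLabel_ne_zero] using hmixed
  have h0 : g 0 = 0 := by
    simpa [gvec_psi1_stringLabel_eq_zero (s := fun _ => false) (by omega : 0 < n) rfl, h2,
      gvec_psi0_stringLabel_ne_zero] using hfalse
  have h1 : g 1 = 0 := by
    simpa [gvec_psi0_stringLabel_eq_zero (s := fun _ => true) (by omega : 0 < n) rfl, h2,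
      gvec_psi1_stringLabel_ne_zero] using htrue
  intro i
  fin_cases i
  exacts [h0, h1, h2]

theorem finrank_span_gvec_triple (hn : 2 ≤ n) :
    Module.finrank ℂ (Submodule.span ℂ {gvec n psi0, gvec n psi1, gvec n psiphi}) = 3 := by
  have h := finrank_span_eq_card (linearIndependent_gvec hn)
  have hrange : Set.range ![gvec n psi0, gvec n psi1, gvec n psiphi] =
      {gvec n psi0, gvec n psi1, gvec n psiphi} := by
    ext w
    simp
    tauto
  rwa [hrange, Fintype.card_fin] at h

theorem finrank_span_gvec_pair (hn : 2 ≤ n) :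
    Module.finrank ℂ (Submodule.span ℂ {gvec n psi0, gvec n psi1}) = 2 := by
  have hli : LinearIndependent ℂ ![gvec n psi0, gvec n psi1] := by
    have h := (linearIndependent_gvec hn).comp (Fin.castSucc : Fin 2 → Fin 3)
      (Fin.castSucc_injective 2)
    convert h using 1
    funext i
    fin_cases i <;> rfl
  have h := finrank_span_eq_card hli
  have hrange : Set.range ![gvec n psi0, gvec n psi1] = {gvec n psi0, gvec n psi1} := by
    ext w
    simp [or_comm]
  rwa [hrange, Fintype.card_fin] at h

end GroundSpace

/-- **Ground spaces** of `H_n`, `H^L_n`, `H^B_n`: they are spanned by the images under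
`Θ` of `ψ₀^{⊗n}, ψ₁^{⊗n}` (resp. also `ψ_φ^{⊗n}` for `H^B_n`); in particular they
are 2-, 2- and 3-dimensional. -/
theorem ground_spaces (n : ℕ) (hn : 3 ≤ n) :
    LinearMap.ker (Matrix.toLin' (Hham n)) =
        Submodule.span ℂ {gvec n psi0, gvec n psi1} ∧
    LinearMap.ker (Matrix.toLin' (HhamL n (by omega))) =
        Submodule.span ℂ {gvec n psi0, gvec n psi1} ∧
    LinearMap.ker (Matrix.toLin' (HhamB n (by omega))) =
        Submodule.span ℂ {gvec n psi0, gvec n psi1, gvec n psiphi} ∧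
    Module.finrank ℂ (LinearMap.ker (Matrix.toLin' (Hham n))) = 2 ∧
    Module.finrank ℂ (LinearMap.ker (Matrix.toLin' (HhamL n (by omega)))) = 2 ∧
    Module.finrank ℂ (LinearMap.ker (Matrix.toLin' (HhamB n (by omega)))) = 3 := by
  have hB : ∀ i : Fin n, i ∈ (Finset.univ.erase (⟨n - 1, by omega⟩ : Fin n)).erase
      ⟨0, by omega⟩ ↔ 0 < (i : ℕ) ∧ (i : ℕ) + 1 < n := by
    intro i
    have := i.isLt
    simp only [Finset.mem_erase, Finset.mem_univ, and_true, ne_eq, Fin.ext_iff]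
    omega
  have h1 : LinearMap.ker (Matrix.toLin' (Hham n)) =
      Submodule.span ℂ {gvec n psi0, gvec n psi1} := by
    rw [Hham_eq]
    exact ker_HhamOn_eq_span_pair hn (by omega) (fun _ _ _ => Finset.mem_univ _) (Finset.mem_univ _)
  have h2 : LinearMap.ker (Matrix.toLin' (HhamL n (by omega))) =
      Submodule.span ℂ {gvec n psi0, gvec n psi1} := by
    rw [HhamL_eq]
    refine ker_HhamOn_eq_span_pair hn (by omega)
      (fun i h h' => Finset.mem_of_mem_erase ((hB i).2 ⟨h, h'⟩)) ?_
    simp only [Finset.mem_erase, Finset.mem_univ, and_true, ne_eq, Fin.ext_iff]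
    omega
  have h3 : LinearMap.ker (Matrix.toLin' (HhamB n (by omega))) =
      Submodule.span ℂ {gvec n psi0, gvec n psi1, gvec n psiphi} := by
    rw [HhamB_eq (by omega)]
    exact ker_HhamOn_eq_span_triple hn hB
  refine ⟨h1, h2, h3, ?_, ?_, ?_⟩
  · rw [h1, finrank_span_gvec_pair (by omega)]
  · rw [h2, finrank_span_gvec_pair (by omega)]
  · rw [h3, finrank_span_gvec_triple (by omega)]
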